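/- Let G(q)=1/((q,q^4;q^5)_∞) and H(q)=1/((q^2,q^3;q^5)_∞), E(q)=(q;q)_∞. Then G(q) G(q^2)^2 - q H(q) H(q^2)^2 = G(q^2) H(q)^2 E(q^5)^2/E(q^{10})^2. -/

import Mathlib

/-- Euler's product E(q) = ∏_{k≥0} (1 - q^{k+1}). -/
noncomputable def E (q : ℂ) : ℂ := ∏' k : ℕ, (1 - q ^ (k + 1))

/-- q-Pochhammer infinite product (a;q)_∞ = ∏_{k≥0} (1 - a q^k). -/
noncomputable def qp (a q : ℂ) : ℂ := ∏' k : ℕ, (1 - a * q ^ k)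

/-- Rogers–Ramanujan function G(q) = 1/((q,q^4;q^5)_∞). -/
noncomputable def G (q : ℂ) : ℂ := 1 / (qp q (q ^ 5) * qp (q ^ 4) (q ^ 5))

/-- Rogers–Ramanujan function H(q) = 1/((q^2,q^3;q^5)_∞). -/
noncomputable def H (q : ℂ) : ℂ := 1 / (qp (q ^ 2) (q ^ 5) * qp (q ^ 3) (q ^ 5))

/-- Rogers–Ramanujan continued fraction product R(q). -/
noncomputable def R (q : ℂ) : ℂ :=
  (qp q (q ^ 5) * qp (q ^ 4) (q ^ 5)) / (qp (q ^ 2) (q ^ 5) * qp (q ^ 3) (q ^ 5))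


open Filter Topology

/-- Jacobi's theta series `∑ s^{j²} w^j` over the integers. -/
noncomputable def thetaSeries (s w : ℂ) : ℂ := ∑' j : ℤ, s ^ (j ^ 2) * w ^ j

lemma summable_norm_mul_pow {p : ℂ} (a : ℂ) (hp : ‖p‖ < 1) :
    Summable fun k : ℕ ↦ ‖-(a * p ^ k)‖ := by
  simpa [norm_mul, norm_pow] using
    (summable_geometric_of_lt_one (norm_nonneg p) hp).mul_left ‖a‖

lemma multipliable_one_sub_mul_pow {p : ℂ} (a : ℂ) (hp : ‖p‖ < 1) :
    Multipliable fun k : ℕ ↦ (1 - a * p ^ k) := by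
  simpa only [sub_eq_add_neg] using
    multipliable_one_add_of_summable (summable_norm_mul_pow a hp)

lemma one_sub_ne_zero_of_norm_lt_one {x : ℂ} (hx : ‖x‖ < 1) : 1 - x ≠ 0 := by
  rw [sub_ne_zero]
  rintro rfl
  simp at hx

lemma norm_mul_pow_lt_one {a p : ℂ} (ha : ‖a‖ < 1) (hp : ‖p‖ < 1) (k : ℕ) :
    ‖a * p ^ k‖ < 1 := by
  rw [norm_mul, norm_pow]
  calc ‖a‖ * ‖p‖ ^ k ≤ ‖a‖ * 1 := by
        gcongr
        exact pow_le_one₀ (norm_nonneg _) hp.le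
    _ < 1 := by simpa using ha

lemma qp_ne_zero {a p : ℂ} (ha : ‖a‖ < 1) (hp : ‖p‖ < 1) : qp a p ≠ 0 := by
  unfold qp
  simp only [sub_eq_add_neg]
  refine tprod_one_add_ne_zero_of_summable (fun k ↦ ?_) (summable_norm_mul_pow a hp)
  rw [← sub_eq_add_neg]
  exact one_sub_ne_zero_of_norm_lt_one (norm_mul_pow_lt_one ha hp k)

lemma tendsto_prod_range_qp {p : ℂ} (a : ℂ) (hp : ‖p‖ < 1) :
    Tendsto (fun N ↦ ∏ k ∈ Finset.range N, (1 - a * p ^ k)) atTop (𝓝 (qp a p)) :=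
  (multipliable_one_sub_mul_pow a hp).tendsto_prod_tprod_nat

lemma qp_eq_mul_qp_sq {p : ℂ} (a : ℂ) (hp : ‖p‖ < 1) :
    qp a p = qp a (p ^ 2) * qp (a * p) (p ^ 2) := by
  have hp2 : ‖p ^ 2‖ < 1 := by
    rw [norm_pow]
    exact pow_lt_one₀ (norm_nonneg _) hp two_ne_zero
  have e1 (k : ℕ) : 1 - a * (p ^ 2) ^ k = 1 - a * p ^ (2 * k) := by rw [pow_mul]
  have e2 (k : ℕ) : 1 - a * p * (p ^ 2) ^ k = 1 - a * p ^ (2 * k + 1) := by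
    rw [← pow_mul]; ring
  have h1 := multipliable_one_sub_mul_pow a hp2
  have h2 := multipliable_one_sub_mul_pow (a * p) hp2
  unfold qp
  simp only [e1, e2] at h1 h2 ⊢
  exact (tprod_even_mul_odd (f := fun k ↦ 1 - a * p ^ k) h1 h2).symm

lemma E_eq_qp (q : ℂ) : E q = qp q q := by
  simp only [E, qp, pow_succ']

/-- The partial products of `(p;p)_∞`. -/
noncomputable def qFactorial (p : ℂ) (n : ℕ) : ℂ := ∏ k ∈ Finset.range n, (1 - p * p ^ k)

/-- `1 / (p;p)_n`, extended by zero to negative `n`. -/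
noncomputable def qFactorialInv (p : ℂ) (n : ℤ) : ℂ :=
  if n < 0 then 0 else (qFactorial p n.toNat)⁻¹

lemma qFactorial_ne_zero {p : ℂ} (hp : ‖p‖ < 1) (n : ℕ) : qFactorial p n ≠ 0 :=
  Finset.prod_ne_zero_iff.2 fun k _ ↦
    one_sub_ne_zero_of_norm_lt_one (norm_mul_pow_lt_one hp hp k)

lemma qFactorial_succ (p : ℂ) (n : ℕ) :
    qFactorial p (n + 1) = qFactorial p n * (1 - p ^ (n + 1)) := by
  rw [qFactorial, Finset.prod_range_succ, ← qFactorial, pow_succ']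

lemma tendsto_qFactorial {p : ℂ} (hp : ‖p‖ < 1) :
    Tendsto (qFactorial p) atTop (𝓝 (qp p p)) :=
  tendsto_prod_range_qp p hp

lemma qFactorialInv_sub_one {p : ℂ} (hp : ‖p‖ < 1) (n : ℤ) :
    qFactorialInv p (n - 1) = (1 - p ^ n) * qFactorialInv p n := by
  rcases lt_trichotomy n 0 with h | rfl | h
  · simp [qFactorialInv, h, show n - 1 < 0 by omega]
  · simp [qFactorialInv]
  · obtain ⟨m, rfl⟩ : ∃ m : ℕ, n = m + 1 := ⟨(n - 1).toNat, by omega⟩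
    have h0 := qFactorial_ne_zero hp (m + 1)
    have e : ((m : ℤ) + 1).toNat = m + 1 := by omega
    rw [qFactorialInv, qFactorialInv, if_neg (by omega), if_neg (by omega), e,
      add_sub_cancel_right, Int.toNat_natCast]
    rw [qFactorial_succ] at h0 ⊢
    have h1 := left_ne_zero_of_mul h0
    have h2 := right_ne_zero_of_mul h0
    have h3 : p ^ ((m : ℤ) + 1) = p ^ (m + 1) := by exact_mod_cast zpow_natCast p (m + 1)
    rw [h3]
    field_simp

lemma tendsto_qFactorialInv {p : ℂ} (hp : ‖p‖ < 1) :
    Tendsto (qFactorialInv p) atTop (𝓝 (qp p p)⁻¹) := by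
  have tendsto_toNat : Tendsto Int.toNat atTop atTop :=
    tendsto_atTop_atTop.2 fun b ↦ ⟨b, fun a ha ↦ by omega⟩
  have h : Tendsto (fun n : ℤ ↦ (qFactorial p n.toNat)⁻¹) atTop (𝓝 (qp p p)⁻¹) :=
    ((tendsto_qFactorial hp).comp tendsto_toNat).inv₀ (qp_ne_zero hp hp)
  refine h.congr' ?_
  filter_upwards [eventually_ge_atTop 0] with n hn
  rw [qFactorialInv, if_neg (by omega)]

lemma exists_norm_qFactorial_le {p : ℂ} (hp : ‖p‖ < 1) : ∃ B, ∀ n, ‖qFactorial p n‖ ≤ B := by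
  obtain ⟨B, hB⟩ := (tendsto_qFactorial hp).norm.bddAbove_range
  exact ⟨B, fun n ↦ hB ⟨n, rfl⟩⟩

lemma exists_norm_qFactorialInv_le {p : ℂ} (hp : ‖p‖ < 1) :
    ∃ B, ∀ n, ‖qFactorialInv p n‖ ≤ B := by
  obtain ⟨B, hB⟩ := ((tendsto_qFactorial hp).inv₀ (qp_ne_zero hp hp)).norm.bddAbove_range
  refine ⟨B, fun n ↦ ?_⟩
  have h (n : ℕ) : ‖(qFactorial p n)⁻¹‖ ≤ B := hB ⟨n, rfl⟩
  rw [qFactorialInv]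
  split_ifs
  · simpa using (norm_nonneg _).trans (h 0)
  · exact h _

/-- The coefficients of the finite form of the Jacobi triple product. -/
noncomputable def centralCoeff (p : ℂ) (N : ℕ) (j : ℤ) : ℂ :=
  qFactorial p (2 * N) * (qFactorialInv p (N + j) * qFactorialInv p (N - j))

lemma centralCoeff_succ {s : ℂ} (hs0 : s ≠ 0) (hs : ‖s‖ < 1) (N : ℕ) (j : ℤ) :
    centralCoeff (s ^ 2) (N + 1) j * s ^ (j ^ 2) =
      (1 + s ^ (4 * N + 2)) * (centralCoeff (s ^ 2) N j * s ^ (j ^ 2)) +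
      s ^ (2 * N + 1) * (centralCoeff (s ^ 2) N (j - 1) * s ^ ((j - 1) ^ 2) +
        centralCoeff (s ^ 2) N (j + 1) * s ^ ((j + 1) ^ 2)) := by
  have hp : ‖s ^ 2‖ < 1 := by
    rw [norm_pow]
    exact pow_lt_one₀ (norm_nonneg _) hs two_ne_zero
  have hr := qFactorialInv_sub_one hp
  simp only [centralCoeff]
  set R := qFactorialInv (s ^ 2) (N + 1 + j) with hR
  set S := qFactorialInv (s ^ 2) (N + 1 - j) with hS
  have a1 : qFactorialInv (s ^ 2) (N + j) = (1 - (s ^ 2) ^ ((N : ℤ) + 1 + j)) * R := by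
    rw [hR, ← hr]; congr 1; ring
  have a2 : qFactorialInv (s ^ 2) (N - j) = (1 - (s ^ 2) ^ ((N : ℤ) + 1 - j)) * S := by
    rw [hS, ← hr]; congr 1; ring
  have a3 : qFactorialInv (s ^ 2) (N + (j - 1)) =
      (1 - (s ^ 2) ^ ((N : ℤ) + j)) * ((1 - (s ^ 2) ^ ((N : ℤ) + 1 + j)) * R) := by
    rw [← a1, ← hr]; congr 1; ring
  have a4 : qFactorialInv (s ^ 2) (N - (j + 1)) =
      (1 - (s ^ 2) ^ ((N : ℤ) - j)) * ((1 - (s ^ 2) ^ ((N : ℤ) + 1 - j)) * S) := by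
    rw [← a2, ← hr]; congr 1; ring
  have a5 : qFactorialInv (s ^ 2) (N - (j - 1)) = S := by rw [hS]; congr 1; ring
  have a6 : qFactorialInv (s ^ 2) (N + (j + 1)) = R := by rw [hR]; congr 1; ring
  rw [a1, a2, a3, a4, a5, a6, show 2 * (N + 1) = 2 * N + 1 + 1 by ring, qFactorial_succ,
    qFactorial_succ, show (j - 1) ^ 2 = j ^ 2 + -(2 * j) + 1 by ring,
    show (j + 1) ^ 2 = j ^ 2 + 2 * j + 1 by ring]
  push_cast
  rw [← hR, ← hS]
  have e2 : (s ^ 2 : ℂ) = s ^ (2 : ℤ) := by norm_cast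
  have z1 (k : ℤ) : (s ^ 2) ^ k = (s ^ k) ^ 2 := by
    rw [e2, ← zpow_mul, mul_comm, zpow_mul]; norm_cast
  simp only [z1]
  simp only [zpow_add₀ hs0, zpow_sub₀ hs0, zpow_neg, zpow_mul, zpow_natCast, zpow_one]
  have hj : s ^ j ≠ 0 := zpow_ne_zero _ hs0
  have hjj : s ^ (2 * j) = (s ^ j) ^ 2 := by rw [mul_comm, zpow_mul]; norm_cast
  simp only [show (s ^ (2 : ℤ)) = s ^ 2 by norm_cast, z1]
  generalize s ^ (j ^ 2) = Q
  generalize qFactorial (s ^ 2) (2 * N) = F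
  generalize s ^ j = u at *
  field_simp
  ring

lemma summable_pow_sq_mul_pow {s w : ℂ} (hs0 : s ≠ 0) (hs : ‖s‖ < 1) (hw : w ≠ 0) :
    Summable fun n : ℕ ↦ ‖s ^ (n ^ 2) * w ^ n‖ := by
  refine summable_of_ratio_test_tendsto_lt_one zero_lt_one
    (.of_forall fun n ↦ by simp [hs0, hw]) ?_
  have h : Tendsto (fun n : ℕ ↦ (‖s‖ ^ 2) ^ n * (‖s‖ * ‖w‖)) atTop (𝓝 0) := by
    simpa using (tendsto_pow_atTop_nhds_zero_of_lt_one (by positivity)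
      (pow_lt_one₀ (norm_nonneg s) hs two_ne_zero)).mul_const (‖s‖ * ‖w‖)
  refine h.congr fun n ↦ ?_
  have h1 := norm_ne_zero_iff.2 hs0
  have h2 := norm_ne_zero_iff.2 hw
  simp only [norm_norm, norm_mul, norm_pow]
  rw [eq_div_iff (by positivity)]
  ring

lemma summable_thetaSeries {s w : ℂ} (hs0 : s ≠ 0) (hs : ‖s‖ < 1) (hw : w ≠ 0) :
    Summable fun j : ℤ ↦ ‖s ^ (j ^ 2) * w ^ j‖ := by
  refine Summable.of_nat_of_neg ?_ ?_
  · exact_mod_cast summable_pow_sq_mul_pow hs0 hs hw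
  · have := summable_pow_sq_mul_pow hs0 hs (inv_ne_zero hw)
    simp only [neg_sq, zpow_neg, ← inv_zpow]
    exact_mod_cast this

/-- The finite form of the Jacobi triple product. -/
lemma hasSum_finite_tripleProduct {s w : ℂ} (hs0 : s ≠ 0) (hs : ‖s‖ < 1) (hw : w ≠ 0) (N : ℕ) :
    HasSum (fun j : ℤ ↦ centralCoeff (s ^ 2) N j * s ^ (j ^ 2) * w ^ j)
      (∏ k ∈ Finset.range N, ((1 + w * s ^ (2 * k + 1)) * (1 + w⁻¹ * s ^ (2 * k + 1)))) := by
  induction N with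
  | zero =>
    have h : centralCoeff (s ^ 2) 0 0 * s ^ ((0 : ℤ) ^ 2) * w ^ (0 : ℤ) = 1 := by
      simp [centralCoeff, qFactorialInv, qFactorial]
    rw [Finset.prod_range_zero, ← h]
    refine hasSum_single 0 fun j hj ↦ ?_
    rcases lt_or_gt_of_ne hj with h | h <;> simp [centralCoeff, qFactorialInv, h]
  | succ N ih =>
    have hl := (Equiv.subRight (1 : ℤ)).hasSum_iff.2 ih
    have hr := (Equiv.addRight (1 : ℤ)).hasSum_iff.2 ih
    convert! (ih.mul_left (1 + s ^ (4 * N + 2))).add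
      (((hl.mul_left w).add (hr.mul_left w⁻¹)).mul_left (s ^ (2 * N + 1))) using 1
    · ext j
      rw [centralCoeff_succ hs0 hs]
      simp only [Function.comp_apply, Equiv.subRight_apply, Equiv.coe_addRight,
        zpow_sub_one₀ hw, zpow_add_one₀ hw]
      field_simp
    · rw [Finset.prod_range_succ]
      field_simp
      ring

/-- The Jacobi triple product identity. -/
theorem tripleProduct {s a b : ℂ} (hs0 : s ≠ 0) (hs : ‖s‖ < 1) (hab : a * b = s ^ 2) :
    qp (s ^ 2) (s ^ 2) * (qp a (s ^ 2) * qp b (s ^ 2)) = thetaSeries s (-a / s) := by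
  have hp : ‖s ^ 2‖ < 1 := by
    rw [norm_pow]
    exact pow_lt_one₀ (norm_nonneg _) hs two_ne_zero
  have hab0 : a * b ≠ 0 := hab ▸ pow_ne_zero 2 hs0
  have ha := left_ne_zero_of_mul hab0
  set w := -a / s with hw
  have hw0 : w ≠ 0 := div_ne_zero (neg_ne_zero.2 ha) hs0
  have hb : b = -(w⁻¹ * s) := by
    rw [hw]
    field_simp
    linear_combination hab
  have hP := qp_ne_zero hp hp
  set P := qp (s ^ 2) (s ^ 2)
  obtain ⟨B, hB⟩ := exists_norm_qFactorial_le hp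
  obtain ⟨B', hB'⟩ := exists_norm_qFactorialInv_le hp
  have hB0 : 0 ≤ B := (norm_nonneg _).trans (hB 0)
  have hB0' : 0 ≤ B' := (norm_nonneg _).trans (hB' 0)
  have hcoeff (j : ℤ) : Tendsto (fun N ↦ centralCoeff (s ^ 2) N j) atTop
      (𝓝 (P * (P⁻¹ * P⁻¹))) := by
    have hN : Tendsto (fun N : ℕ ↦ (N : ℤ)) atTop atTop := tendsto_natCast_atTop_atTop
    refine ((tendsto_qFactorial hp).comp (tendsto_id.const_mul_atTop' two_pos)).mul
      (((tendsto_qFactorialInv hp).comp (tendsto_atTop_add_const_right _ j hN)).mul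
        ((tendsto_qFactorialInv hp).comp (tendsto_atTop_add_const_right _ (-j) hN)))
  have hlim : Tendsto (fun N ↦ ∑' j : ℤ, centralCoeff (s ^ 2) N j * s ^ (j ^ 2) * w ^ j) atTop
      (𝓝 (∑' j : ℤ, P * (P⁻¹ * P⁻¹) * s ^ (j ^ 2) * w ^ j)) := by
    refine tendsto_tsum_of_dominated_convergence
      ((summable_thetaSeries hs0 hs hw0).mul_left (B * (B' * B')))
      (fun j ↦ ((hcoeff j).mul_const _).mul_const _) (.of_forall fun N j ↦ ?_)
    rw [mul_assoc, norm_mul]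
    gcongr
    rw [centralCoeff, norm_mul, norm_mul]
    gcongr
    exacts [hB _, hB' _, hB' _]
  have hprod : Tendsto (fun N ↦ ∑' j : ℤ, centralCoeff (s ^ 2) N j * s ^ (j ^ 2) * w ^ j) atTop
      (𝓝 (qp a (s ^ 2) * qp b (s ^ 2))) := by
    refine ((tendsto_prod_range_qp a hp).mul (tendsto_prod_range_qp b hp)).congr fun N ↦ ?_
    rw [(hasSum_finite_tripleProduct hs0 hs hw0 N).tsum_eq, ← Finset.prod_mul_distrib]
    refine Finset.prod_congr rfl fun k _ ↦ ?_
    rw [show a = -(w * s) by rw [hw]; field_simp, hb]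
    ring
  rw [tendsto_nhds_unique hprod hlim, thetaSeries]
  simp only [mul_assoc, tsum_mul_left]
  field_simp

lemma isCompl_range_parity : IsCompl
    (Set.range fun x : ℤ × ℤ ↦ (x.1 + x.2, x.1 - x.2))
    (Set.range fun x : ℤ × ℤ ↦ (x.1 + x.2 + 1, x.1 - x.2)) := by
  rw [isCompl_iff, Set.disjoint_left, codisjoint_iff, Set.top_eq_univ,
    Set.eq_univ_iff_forall]
  refine ⟨?_, fun ⟨m, n⟩ ↦ ?_⟩
  · rintro _ ⟨⟨a, b⟩, rfl⟩ ⟨⟨c, d⟩, h⟩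
    simp only [Prod.mk.injEq] at h
    omega
  · rcases Int.emod_two_eq_zero_or_one (m + n) with h | h
    · exact .inl ⟨((m + n) / 2, (m - n) / 2), by simp only [Prod.mk.injEq]; omega⟩
    · exact .inr ⟨((m + n - 1) / 2, (m - n - 1) / 2), by simp only [Prod.mk.injEq]; omega⟩

/-- Multiplication formula for the theta series. -/
theorem thetaSeries_mul_thetaSeries {s x y : ℂ} (hs0 : s ≠ 0) (hs : ‖s‖ < 1) (hx : x ≠ 0)
    (hy : y ≠ 0) :
    thetaSeries s (x * y) * thetaSeries s (x / y) =
      thetaSeries (s ^ 2) (x ^ 2) * thetaSeries (s ^ 2) (y ^ 2) +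
      s * x * y * (thetaSeries (s ^ 2) (s ^ 2 * x ^ 2) * thetaSeries (s ^ 2) (s ^ 2 * y ^ 2)) := by
  have hp : ‖s ^ 2‖ < 1 := by
    rw [norm_pow]
    exact pow_lt_one₀ (norm_nonneg _) hs two_ne_zero
  have hs2 : s ^ 2 ≠ 0 := pow_ne_zero 2 hs0
  have hx2 : x ^ 2 ≠ 0 := pow_ne_zero 2 hx
  have hy2 : y ^ 2 ≠ 0 := pow_ne_zero 2 hy
  have hmul {r u v : ℂ} (hr0 : r ≠ 0) (hr : ‖r‖ < 1) (hu : u ≠ 0) (hv : v ≠ 0) :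
      HasSum (fun i : ℤ × ℤ ↦ r ^ (i.1 ^ 2) * u ^ i.1 * (r ^ (i.2 ^ 2) * v ^ i.2))
        (thetaSeries r u * thetaSeries r v) := by
    have h1 := summable_thetaSeries hr0 hr hu
    have h2 := summable_thetaSeries hr0 hr hv
    rw [thetaSeries, thetaSeries, tsum_mul_tsum_of_summable_norm h1 h2]
    exact (summable_mul_of_summable_norm h1 h2).hasSum
  have sq_zpow (z : ℂ) (k : ℤ) : (z ^ 2) ^ k = z ^ (2 * k) := by
    rw [zpow_mul]; norm_cast
  have expand (m n : ℤ) : s ^ (m ^ 2) * (x * y) ^ m * (s ^ (n ^ 2) * (x / y) ^ n) =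
      s ^ (m ^ 2 + n ^ 2) * (x ^ (m + n) * y ^ (m - n)) := by
    rw [zpow_add₀ hs0, zpow_add₀ hx, zpow_sub₀ hy, mul_zpow, div_zpow]
    ring
  refine (hmul hs0 hs (mul_ne_zero hx hy) (div_ne_zero hx hy)).unique ?_
  refine HasSum.add_isCompl isCompl_range_parity ?_ ?_
  · have hinj : Function.Injective fun x : ℤ × ℤ ↦ (x.1 + x.2, x.1 - x.2) := fun a b h ↦ by
      simp only [Prod.mk.injEq] at h
      ext <;> omega
    refine hinj.hasSum_range_iff (f := fun i : ℤ × ℤ ↦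
      s ^ (i.1 ^ 2) * (x * y) ^ i.1 * (s ^ (i.2 ^ 2) * (x / y) ^ i.2)).2 ?_
    convert! hmul hs2 hp hx2 hy2 using 1
    ext ⟨a, b⟩
    simp only [Function.comp_apply, sq_zpow, expand]
    rw [show (a + b) ^ 2 + (a - b) ^ 2 = 2 * a ^ 2 + 2 * b ^ 2 by ring,
      show a + b + (a - b) = 2 * a by ring, show a + b - (a - b) = 2 * b by ring,
      zpow_add₀ hs0]
    ring
  · have hinj : Function.Injective fun x : ℤ × ℤ ↦ (x.1 + x.2 + 1, x.1 - x.2) := fun a b h ↦ by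
      simp only [Prod.mk.injEq] at h
      ext <;> omega
    refine hinj.hasSum_range_iff (f := fun i : ℤ × ℤ ↦
      s ^ (i.1 ^ 2) * (x * y) ^ i.1 * (s ^ (i.2 ^ 2) * (x / y) ^ i.2)).2 ?_
    convert! (hmul hs2 hp (mul_ne_zero hs2 hx2) (mul_ne_zero hs2 hy2)).mul_left (s * x * y) using 1
    ext ⟨a, b⟩
    rw [Function.comp_apply, expand]
    simp only [mul_zpow, sq_zpow]
    rw [show (a + b + 1) ^ 2 + (a - b) ^ 2 = 2 * a ^ 2 + 2 * b ^ 2 + 2 * a + 2 * b + 1 by ring,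
      show a + b + 1 + (a - b) = 2 * a + 1 by ring,
      show a + b + 1 - (a - b) = 2 * b + 1 by ring]
    simp only [zpow_add₀ hs0, zpow_add₀ hx, zpow_add₀ hy, zpow_one]
    ring

lemma thetaSeries_sq_mul {s w : ℂ} (hs0 : s ≠ 0) (hw : w ≠ 0) :
    s * w * thetaSeries s (s ^ 2 * w) = thetaSeries s w := by
  rw [thetaSeries, thetaSeries, ← tsum_mul_left,
    ← (Equiv.addRight (1 : ℤ)).tsum_eq fun j : ℤ ↦ s ^ (j ^ 2) * w ^ j]
  refine tsum_congr fun j ↦ ?_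
  have h : (s ^ 2) ^ j = s ^ (2 * j) := by
    rw [zpow_mul]; norm_cast
  rw [Equiv.coe_addRight, show (j + 1) ^ 2 = j ^ 2 + 2 * j + 1 by ring, zpow_add₀ hs0,
    zpow_add₀ hs0, zpow_add₀ hw, zpow_one, zpow_one, mul_zpow, h]
  ring

lemma thetaSeries_mul_eq_det {s x y : ℂ} (hs0 : s ≠ 0) (hs : ‖s‖ < 1) (hx : x ≠ 0)
    (hy : y ≠ 0) :
    y * (thetaSeries s (-(x * y) / s) * thetaSeries s (-(x / y) / s)) =
      y * (thetaSeries (s ^ 2) (x ^ 2 / s ^ 2) * thetaSeries (s ^ 2) (y ^ 2)) -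
      x * (thetaSeries (s ^ 2) (x ^ 2) * thetaSeries (s ^ 2) (y ^ 2 / s ^ 2)) := by
  have h := thetaSeries_mul_thetaSeries (x := -x / s) (y := y) hs0 hs
    (div_ne_zero (neg_ne_zero.2 hx) hs0) hy
  have h2 := thetaSeries_sq_mul (s := s ^ 2) (w := y ^ 2 / s ^ 2) (pow_ne_zero 2 hs0)
    (div_ne_zero (pow_ne_zero 2 hy) (pow_ne_zero 2 hs0))
  rw [show -x / s * y = -(x * y) / s by ring, show -x / s / y = -(x / y) / s by ring,
    show (-x / s) ^ 2 = x ^ 2 / s ^ 2 by ring,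
    show s ^ 2 * (x ^ 2 / s ^ 2) = x ^ 2 by field_simp] at h
  rw [show (s ^ 2) ^ 2 * (y ^ 2 / s ^ 2) = s ^ 2 * y ^ 2 by field_simp,
    show s ^ 2 * (y ^ 2 / s ^ 2) = y ^ 2 by field_simp] at h2
  rw [h, ← h2]
  field_simp
  ring

/-- Weierstrass' three-term relation for theta functions. -/
theorem thetaSeries_three_term {s x y u v : ℂ} (hs0 : s ≠ 0) (hs : ‖s‖ < 1) (hx : x ≠ 0)
    (hy : y ≠ 0) (hu : u ≠ 0) (hv : v ≠ 0) :
    thetaSeries s (-(x * y) / s) * thetaSeries s (-(x / y) / s) *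
        (thetaSeries s (-(u * v) / s) * thetaSeries s (-(u / v) / s)) -
      thetaSeries s (-(x * v) / s) * thetaSeries s (-(x / v) / s) *
        (thetaSeries s (-(u * y) / s) * thetaSeries s (-(u / y) / s)) +
      x / y * (thetaSeries s (-(y * v) / s) * thetaSeries s (-(y / v) / s) *
        (thetaSeries s (-(u * x) / s) * thetaSeries s (-(u / x) / s))) = 0 := by
  have key {a b : ℂ} (ha : a ≠ 0) (hb : b ≠ 0) :=
    eq_div_of_mul_eq hb ((mul_comm _ _).trans (thetaSeries_mul_eq_det hs0 hs ha hb))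
  rw [key hx hy, key hu hv, key hx hv, key hu hy, key hy hv, key hu hx]
  field_simp
  ring

lemma qp_three_term {q : ℂ} (hq0 : q ≠ 0) (hq : ‖q‖ < 1) :
    (qp (q ^ 5) (q ^ 10) * qp (q ^ 5) (q ^ 10)) * (qp q (q ^ 10) * qp (q ^ 9) (q ^ 10)) *
        (qp (q ^ 4) (q ^ 10) * qp (q ^ 6) (q ^ 10)) ^ 2 -
      (qp (q ^ 3) (q ^ 10) * qp (q ^ 7) (q ^ 10)) ^ 2 *
        ((qp (q ^ 4) (q ^ 10) * qp (q ^ 6) (q ^ 10)) *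
          (qp (q ^ 2) (q ^ 10) * qp (q ^ 8) (q ^ 10))) +
      q * ((qp (q ^ 2) (q ^ 10) * qp (q ^ 8) (q ^ 10)) ^ 2 *
        ((qp (q ^ 3) (q ^ 10) * qp (q ^ 7) (q ^ 10)) *
          (qp q (q ^ 10) * qp (q ^ 9) (q ^ 10)))) = 0 := by
  have hs0 : q ^ 5 ≠ 0 := pow_ne_zero 5 hq0
  have hs : ‖q ^ 5‖ < 1 := by
    rw [norm_pow]
    exact pow_lt_one₀ (norm_nonneg _) hq (by norm_num)
  have hp : ‖q ^ 10‖ < 1 := by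
    rw [norm_pow]
    exact pow_lt_one₀ (norm_nonneg _) hq (by norm_num)
  have hP := qp_ne_zero hp hp
  have h := thetaSeries_three_term hs0 hs (pow_ne_zero 3 hq0) (pow_ne_zero 2 hq0)
    (pow_ne_zero 4 hq0) one_ne_zero
  have jtp (a b : ℂ) (hab : a * b = (q ^ 5) ^ 2) := tripleProduct hs0 hs hab
  simp only [mul_one, div_one] at h
  rw [show q ^ 3 * q ^ 2 = q ^ 5 by ring, show q ^ 3 / q ^ 2 = q by field_simp,
    show q ^ 4 * q ^ 2 = q ^ 6 by ring, show q ^ 4 / q ^ 2 = q ^ 2 by field_simp,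
    show q ^ 4 * q ^ 3 = q ^ 7 by ring, show q ^ 4 / q ^ 3 = q by field_simp,
    ← jtp (q ^ 5) (q ^ 5) (by ring), ← jtp q (q ^ 9) (by ring),
    ← jtp (q ^ 4) (q ^ 6) (by ring), ← jtp (q ^ 3) (q ^ 7) (by ring),
    ← jtp (q ^ 6) (q ^ 4) (by ring), ← jtp (q ^ 2) (q ^ 8) (by ring),
    ← jtp (q ^ 7) (q ^ 3) (by ring), show (q ^ 5) ^ 2 = q ^ 10 by ring] at h
  refine (mul_eq_zero.1 ?_).resolve_left (pow_ne_zero 4 hP)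
  linear_combination h

theorem stmt_4 : ∀ q : ℂ, ‖q‖ < 1 →
    G q * G (q ^ 2) ^ 2 - q * H q * H (q ^ 2) ^ 2
      = G (q ^ 2) * H q ^ 2 * E (q ^ 5) ^ 2 / E (q ^ 10) ^ 2 := by
  intro q hq
  rcases eq_or_ne q 0 with rfl | hq0
  · simp [G, H, E, qp]
  have hpow (n : ℕ) (hn : n ≠ 0) : ‖q ^ n‖ < 1 := by
    rw [norm_pow]
    exact pow_lt_one₀ (norm_nonneg _) hq hn
  have hne (n : ℕ) (hn : n ≠ 0) : qp (q ^ n) (q ^ 10) ≠ 0 :=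
    qp_ne_zero (hpow n hn) (hpow 10 (by norm_num))
  have split (a : ℂ) : qp a (q ^ 5) = qp a (q ^ 10) * qp (a * q ^ 5) (q ^ 10) := by
    rw [qp_eq_mul_qp_sq a (hpow 5 (by norm_num)), ← pow_mul]
  have h := qp_three_term hq0 hq
  have h1 : qp q (q ^ 10) ≠ 0 := by simpa using hne 1
  have h2 := hne 2 (by norm_num)
  have h3 := hne 3 (by norm_num)
  have h4 := hne 4 (by norm_num)
  have h6 := hne 6 (by norm_num)
  have h7 := hne 7 (by norm_num)
  have h8 := hne 8 (by norm_num)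
  have h9 := hne 9 (by norm_num)
  have h10 := hne 10 (by norm_num)
  simp only [G, H, E_eq_qp, split, ← pow_mul, ← pow_add, ← pow_succ', Nat.reduceMul, Nat.reduceAdd]
  field_simp
  linear_combination -h
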